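/- arXiv:2507.15665 — 2 statements merged into one kernel-verified Lean document; each statement's English description precedes it below -/
import Mathlib

section
/- For every integer s ≥ 1, every natural number c, and every positive integer n, the determinant of the n×n matrix whose (i,j)-entry (0 ≤ i,j ≤ n−1) is (s+2)^{j}·binom(i+j+c, i) + binom(i−j+c, i) equals 2·(s+1)^{n(n−1)/2}. -/
open scoped BigOperators

/-- Generalized binomial coefficient: `binom α p = α(α−1)⋯(α−p+1)/p!`. -/
def binom (α : ℤ) (p : ℕ) : ℚ :=
  (∏ k ∈ Finset.range p, ((α : ℚ) - (k : ℚ))) / (p.factorial : ℚ)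

theorem binom_eq_ringChoose (α : ℤ) (p : ℕ) : binom α p = ((Ring.choose α p : ℤ) : ℚ) := by
  have h := Ring.descPochhammer_eq_factorial_smul_choose α p
  rw [← Polynomial.eval_eq_smeval, nsmul_eq_mul] at h
  have h' : (((descPochhammer ℤ p).eval α : ℤ) : ℚ) = ∏ k ∈ Finset.range p, ((α : ℚ) - (k : ℚ)) := by
    rw [descPochhammer_eval_eq_prod_range]
    push_cast
    rfl
  rw [binom, ← h', h]
  push_cast
  field_simp

theorem binom_succ_succ (α : ℤ) (p : ℕ) : binom (α + 1) (p + 1) = binom α p + binom α (p + 1) := by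
  simp only [binom_eq_ringChoose, Ring.choose_succ_succ]
  push_cast
  rfl

theorem binom_natCast (m p : ℕ) : binom (m : ℤ) p = (m.choose p : ℚ) := by
  rw [binom_eq_ringChoose, Ring.choose_natCast]
  norm_cast

open PowerSeries in
theorem coeff_mk_one_pow_succ (m i : ℕ) :
    coeff i ((mk 1 : ℚ⟦X⟧) ^ (m + 1)) = binom ((i : ℤ) + m) i := by
  rw [mk_one_pow_eq_mk_choose_add, coeff_mk, ← Nat.cast_add, binom_natCast, add_comm m i,
    Nat.choose_symm_add]

open PowerSeries in
theorem coeff_mk_one_pow_succ_mul_one_sub_pow (m j i : ℕ) :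
    coeff i ((mk 1 : ℚ⟦X⟧) ^ (m + 1) * (1 - X) ^ j) = binom ((i : ℤ) - j + m) i := by
  induction j generalizing i with
  | zero => simp [coeff_mk_one_pow_succ]
  | succ j ih =>
    rw [pow_succ (1 - X), ← mul_assoc, mul_sub, mul_one, map_sub]
    cases i with
    | zero => rw [ih, coeff_zero_mul_X]; simp [binom]
    | succ i =>
      rw [coeff_succ_mul_X, ih, ih, sub_eq_iff_eq_add']
      convert binom_succ_succ ((i : ℤ) - j + m) i using 2 <;> push_cast <;> ring_nf

/-- The Dickson-type polynomials, shifted by `b`: if `x * y = a` and `x + y = t + b`, then the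
`j`-th one takes the value `x ^ j + y ^ j` at `t`. -/
noncomputable def powerSumPoly (a b : ℚ) : ℕ → Polynomial ℚ
  | 0 => 2
  | 1 => Polynomial.X + Polynomial.C b
  | j + 2 => (Polynomial.X + Polynomial.C b) * powerSumPoly a b (j + 1)
      - Polynomial.C a * powerSumPoly a b j

theorem aeval_powerSumPoly {R : Type*} [CommRing R] [Algebra ℚ R] (a b : ℚ) {x y t : R}
    (hmul : x * y = algebraMap ℚ R a) (hadd : x + y = t + algebraMap ℚ R b) (j : ℕ) :
    Polynomial.aeval t (powerSumPoly a b j) = x ^ j + y ^ j := by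
  induction j using Nat.twoStepInduction with
  | zero => rw [powerSumPoly, map_ofNat]; norm_num
  | one => simp [powerSumPoly, hadd]
  | more j h₀ h₁ =>
    simp only [powerSumPoly, map_sub, map_mul, map_add, Polynomial.aeval_X, Polynomial.aeval_C,
      h₀, h₁, ← hmul, ← hadd]
    ring

theorem natDegree_powerSumPoly_le (a b : ℚ) (j : ℕ) : (powerSumPoly a b j).natDegree ≤ j := by
  induction j using Nat.twoStepInduction with
  | zero => exact (Polynomial.natDegree_ofNat 2).le
  | one => simp [powerSumPoly]
  | more j h₀ h₁ =>
    rw [powerSumPoly]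
    refine (Polynomial.natDegree_sub_le _ _).trans (max_le ?_ ?_)
    · refine Polynomial.natDegree_mul_le.trans ?_
      rw [Polynomial.natDegree_X_add_C]
      lia
    · exact (Polynomial.natDegree_C_mul_le _ _).trans (by lia)

theorem coeff_powerSumPoly_succ_self (a b : ℚ) (j : ℕ) :
    (powerSumPoly a b (j + 1)).coeff (j + 1) = 1 := by
  induction j with
  | zero => simp [powerSumPoly]
  | succ j ih =>
    have h₀ : (powerSumPoly a b j).coeff (j + 2) = 0 :=
      Polynomial.coeff_eq_zero_of_natDegree_lt
        (by have := natDegree_powerSumPoly_le a b j; lia)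
    have h₁ : (powerSumPoly a b (j + 1)).coeff (j + 2) = 0 :=
      Polynomial.coeff_eq_zero_of_natDegree_lt
        (by have := natDegree_powerSumPoly_le a b (j + 1); lia)
    rw [powerSumPoly, add_mul, Polynomial.coeff_sub, Polynomial.coeff_add,
      Polynomial.coeff_X_mul, Polynomial.coeff_C_mul, Polynomial.coeff_C_mul, h₀, h₁, ih]
    ring

open PowerSeries in
theorem det_coeff_mul_aeval {R : Type*} [CommRing R] (n : ℕ) (F w : R⟦X⟧)
    (hF : constantCoeff F = 1) (hw : constantCoeff w = 0) (p : ℕ → Polynomial R)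
    (hp : ∀ j, (p j).natDegree ≤ j) :
    (Matrix.of fun i j : Fin n => coeff (i : ℕ) (F * Polynomial.aeval w (p j))).det =
      (∏ i ∈ Finset.range n, coeff 1 w ^ i) * ∏ j ∈ Finset.range n, (p j).coeff j := by
  obtain ⟨v, rfl⟩ := X_dvd_iff.mpr hw
  set L : Matrix (Fin n) (Fin n) R := Matrix.of fun i k => coeff (i : ℕ) (F * (X * v) ^ (k : ℕ))
  set U : Matrix (Fin n) (Fin n) R := Matrix.of fun k j => (p j).coeff k
  have hLU : (Matrix.of fun i j : Fin n => coeff (i : ℕ) (F * Polynomial.aeval (X * v) (p j))) =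
      L * U := by
    ext i j
    rw [Matrix.mul_apply, Matrix.of_apply,
      Polynomial.aeval_eq_sum_range' ((hp j).trans_lt j.isLt), Finset.mul_sum, map_sum,
      ← Fin.sum_univ_eq_sum_range
        (fun k => coeff (i : ℕ) (F * ((p j).coeff k • (X * v) ^ k))) n]
    refine Finset.sum_congr rfl fun k _ => ?_
    rw [mul_smul_comm, coeff_smul, smul_eq_mul, mul_comm]
    rfl
  have hcoeff (k : ℕ) : F * (X * v) ^ k = X ^ k * (F * v ^ k) := by ring
  have hL : L.det = ∏ i ∈ Finset.range n, coeff 1 (X * v) ^ i := by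
    rw [Matrix.det_of_isLowerTriangular L, ← Fin.prod_univ_eq_prod_range]
    · refine Finset.prod_congr rfl fun i _ => ?_
      have hv : coeff 1 (X * v) = coeff 0 v := coeff_succ_X_mul 0 v
      simp [L, hcoeff, coeff_X_pow_mul', hv, hF]
    · intro i k hik
      simp [L, hcoeff, coeff_X_pow_mul', not_le.mpr (show i < k from hik)]
  have hU : U.det = ∏ j ∈ Finset.range n, (p j).coeff j := by
    rw [Matrix.det_of_isUpperTriangular, ← Fin.prod_univ_eq_prod_range]
    · rfl
    · intro k j hjk
      have : (j : ℕ) < k := hjk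
      exact Polynomial.coeff_eq_zero_of_natDegree_lt ((hp j).trans_lt this)
  rw [hLU, Matrix.det_mul, hL, hU]

theorem stmt_14 (s c : ℕ) (hs : 1 ≤ s) (n : ℕ) (hn : 0 < n) :
    (Matrix.of fun i j : Fin n =>
        ((s : ℚ) + 2) ^ (j : ℕ) * binom (((i : ℕ) : ℤ) + ((j : ℕ) : ℤ) + (c : ℤ)) (i : ℕ)
          + binom (((i : ℕ) : ℤ) - ((j : ℕ) : ℤ) + (c : ℤ)) (i : ℕ)).det =
      2 * ((s : ℚ) + 1) ^ (n * (n - 1) / 2) := by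
  open PowerSeries in
  set a : ℚ := (s : ℚ) + 2 with ha
  set E : ℚ⟦X⟧ := mk 1 with hE
  set w : ℚ⟦X⟧ := C a * E + (1 - X) - C (a + 1) with hw
  have hEX : E * (1 - X) = 1 := mk_one_mul_one_sub_eq_one ℚ
  have hE₀ : constantCoeff E = 1 := by simp [hE, ← coeff_zero_eq_constantCoeff_apply]
  have hw₀ : constantCoeff w = 0 := by simp [hw, hE₀]
  have hw₁ : coeff 1 w = s + 1 := by
    rw [hw, map_sub, map_add, map_sub, coeff_C_mul, hE, coeff_mk, coeff_one_X, coeff_one,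
      coeff_C]
    simp [ha]
    ring
  have hmul : C a * E * (1 - X) = algebraMap ℚ ℚ⟦X⟧ a := by
    rw [mul_assoc, hEX, mul_one]
    rfl
  have hadd : C a * E + (1 - X) = w + algebraMap ℚ ℚ⟦X⟧ (a + 1) :=
    (sub_add_cancel _ _).symm
  have hentry (i j : ℕ) : a ^ j * binom ((i : ℤ) + j + c) i + binom ((i : ℤ) - j + c) i =
      coeff i (E ^ (c + 1) * Polynomial.aeval w (powerSumPoly a (a + 1) j)) := by
    rw [aeval_powerSumPoly a (a + 1) hmul hadd, mul_add, map_add,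
      coeff_mk_one_pow_succ_mul_one_sub_pow]
    have : E ^ (c + 1) * (C a * E) ^ j = C (a ^ j) * E ^ (j + c + 1) := by
      rw [map_pow]
      ring
    rw [this, coeff_C_mul, coeff_mk_one_pow_succ]
    push_cast
    rw [add_assoc]
  simp only [hentry]
  rw [det_coeff_mul_aeval n (E ^ (c + 1)) w (by simp [hE₀]) hw₀ (powerSumPoly a (a + 1))
    (natDegree_powerSumPoly_le a (a + 1)), hw₁, Finset.prod_pow_eq_pow_sum,
    Finset.sum_range_id, mul_comm]
  congr 1
  obtain ⟨m, rfl⟩ := Nat.exists_eq_succ_of_ne_zero hn.ne'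
  rw [Finset.prod_range_succ']
  simp [coeff_powerSumPoly_succ_self, powerSumPoly]
end

section
/- For all integers m ≥ 1, a ≥ 0, ρ ≥ 1 and all natural numbers i, j, one has the identity binom(mi−j+a, mi+a) − δ_{j,0} = Σ_{k=0}^{j} (−1)^k · C(2ρ, k) · binom(mi−(j−k)+a, mi+a+2ρ), where δ_{j,0} equals 1 if j = 0 and 0 otherwise, and the sum is over integers k with 0 ≤ k ≤ j. (Equivalently, the formal power series Σ_{i,j≥0} binom(mi−j+a, mi+a) u^i v^j − 1/(1−u) equals (1−v)^{2ρ} · Σ_{i,j≥0} binom(mi−j+a, mi+a+2ρ) u^i v^j.) -/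
open scoped BigOperators

theorem binom_add_one_succ (x : ℤ) (p : ℕ) :
    binom (x + 1) (p + 1) = binom x (p + 1) + binom x p := by
  have h : ∏ k ∈ Finset.range (p + 1), (((x + 1 : ℤ) : ℚ) - (k : ℚ)) =
      (∏ k ∈ Finset.range p, ((x : ℚ) - (k : ℚ))) * (x + 1) := by
    rw [Finset.prod_range_succ']
    push_cast
    congr 1
    · exact Finset.prod_congr rfl fun k _ => by ring
    · ring
  have hp : (p.factorial : ℚ) ≠ 0 := by positivity
  unfold binom
  rw [h, Finset.prod_range_succ, Nat.factorial_succ]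
  push_cast
  field_simp
  ring

theorem binom_natCast_s17 (n p : ℕ) : binom n p = n.choose p := by
  induction n generalizing p with
  | zero => cases p <;> simp [binom, Finset.prod_range_succ']
  | succ n ih =>
    cases p with
    | zero => simp [binom]
    | succ p =>
      push_cast
      rw [binom_add_one_succ, ih, ih, Nat.choose_succ_succ]
      push_cast
      ring

open PowerSeries in
theorem PowerSeries.coeff_one_sub_X_pow {R : Type*} [CommRing R] (r k : ℕ) :
    coeff k ((1 - X : R⟦X⟧) ^ r) = (-1) ^ k * (r.choose k : R) := by
  have h : (1 - X : R⟦X⟧) ^ r =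
      rescale (-1) (((1 + Polynomial.X : Polynomial R) ^ r : Polynomial R) : R⟦X⟧) := by
    simp [rescale_X, sub_eq_add_neg]
  rw [h, coeff_rescale, Polynomial.coeff_coe, Polynomial.coeff_one_add_X_pow]

/-- The generating series `∑ j, binom (n - j) (n + r) v ^ j`. -/
noncomputable def binomSeries (n r : ℕ) : PowerSeries ℚ :=
  PowerSeries.mk fun j => binom ((n : ℤ) - (j : ℤ)) (n + r)

theorem one_sub_X_mul_binomSeries (n r : ℕ) :
    (1 - PowerSeries.X) * binomSeries n (r + 1) =
      (if r = 0 then 1 else 0) - binomSeries n r := by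
  have hc (s : ℕ) : binom (n : ℤ) (n + s) = if s = 0 then 1 else 0 := by
    rw [binom_natCast_s17]
    split_ifs with h
    · simp [h]
    · rw [Nat.choose_eq_zero_of_lt (by omega), Nat.cast_zero]
  ext j
  rw [sub_mul, one_mul]
  cases j with
  | zero =>
    rcases eq_or_ne r 0 with rfl | h
    · simpa [binomSeries] using by rw [hc 1, show binom (n : ℤ) n = 1 from hc 0]; simp
    · simp [binomSeries, hc, h]
  | succ j =>
    have h := binom_add_one_succ ((n : ℤ) - ((j : ℤ) + 1)) (n + r)
    rw [show (n : ℤ) - ((j : ℤ) + 1) + 1 = n - j by ring] at h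
    rw [map_sub, map_sub, PowerSeries.coeff_succ_X_mul]
    have h0 : PowerSeries.coeff (j + 1) (if r = 0 then 1 else 0 : PowerSeries ℚ) = 0 := by
      split_ifs <;> simp [PowerSeries.coeff_one]
    simp only [h0, binomSeries, PowerSeries.coeff_mk, Nat.cast_add, Nat.cast_one, ← add_assoc]
    linear_combination -h

theorem one_sub_X_pow_mul_binomSeries (n r : ℕ) :
    (1 - PowerSeries.X) ^ (r + 1) * binomSeries n (r + 1) =
      (-1) ^ (r + 1) * (binomSeries n 0 - 1) := by
  induction r with
  | zero => simp [one_sub_X_mul_binomSeries]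
  | succ r ih =>
    rw [pow_succ, mul_assoc, one_sub_X_mul_binomSeries, if_neg r.succ_ne_zero, zero_sub,
      mul_neg, ih]
    ring

theorem stmt_17 (m a ρ : ℕ) (hm : 1 ≤ m) (hρ : 1 ≤ ρ) (i j : ℕ) :
    binom (((m * i + a : ℕ) : ℤ) - (j : ℤ)) (m * i + a) - (if j = 0 then 1 else 0) =
      ∑ k ∈ Finset.range (j + 1),
        (-1 : ℚ) ^ k * (((2 * ρ).choose k : ℚ)) *
          binom (((m * i + a : ℕ) : ℤ) - ((j - k : ℕ) : ℤ)) (m * i + a + 2 * ρ) := by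
  generalize m * i + a = n
  have h := one_sub_X_pow_mul_binomSeries n (2 * ρ - 1)
  rw [show 2 * ρ - 1 + 1 = 2 * ρ by omega, (even_two_mul ρ).neg_one_pow, one_mul] at h
  replace h := congrArg (PowerSeries.coeff j) h
  rw [PowerSeries.coeff_mul, Finset.Nat.sum_antidiagonal_eq_sum_range_succ_mk, map_sub,
    PowerSeries.coeff_one] at h
  simp only [PowerSeries.coeff_one_sub_X_pow, binomSeries, PowerSeries.coeff_mk, add_zero] at h
  exact h.symm
end
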